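/- Under the RA model with W irreducible: suppose k, l are two agents such that W_{kl} > 0. Then for all δ > 0 satisfying δ ≤ min{α·W_{kl}, (1−α)/(2−α)}, and for all ε > 0, there exists a time t_ε such that for all t ≥ t_ε, P(C^{(0)}_{t,k}(δ) ∩ C^{(1)}_{t,l}(δ)) ≤ δ + ε and P(C^{(1)}_{t,k}(δ) ∩ C^{(0)}_{t,l}(δ)) ≤ δ + ε. (If there is a directed edge from l to k, the probability that k and l are simultaneously δ-close to opposite extremes tends to at most δ.) -/

import Mathlib

open MeasureTheory ProbabilityTheory Filter

namespace RA

variable {Ω : Type*}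

/-- History σ-algebra generated by `x 1, …, x t` and `a 1, …, a (t-1)`. -/
def hist {N : ℕ} [MeasurableSpace Ω] (x a : ℕ → Ω → Fin N → ℝ) (t : ℕ) :
    MeasurableSpace Ω :=
  (⨆ s ∈ Finset.Icc 1 t, MeasurableSpace.comap (x s) inferInstance) ⊔
  (⨆ s ∈ Finset.Ico 1 t, MeasurableSpace.comap (a s) inferInstance)

/-- The Random Actions (RA) opinion dynamics model. -/
structure IsRAModel {N : ℕ} [MeasurableSpace Ω] (μ : Measure Ω) (α : ℝ)
    (W : Matrix (Fin N) (Fin N) ℝ) (x a : ℕ → Ω → Fin N → ℝ) : Prop where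
  isProb : IsProbabilityMeasure μ
  alpha_mem : α ∈ Set.Ioo (0 : ℝ) 1
  W_nonneg : ∀ i j, 0 ≤ W i j
  W_rowsum : ∀ i, ∑ j, W i j = 1
  x_meas : ∀ t, Measurable (x t)
  a_meas : ∀ t, Measurable (a t)
  x_mem : ∀ t, 1 ≤ t → ∀ ω i, x t ω i ∈ Set.Icc (0 : ℝ) 1
  a_mem : ∀ t, 1 ≤ t → ∀ ω i, a t ω i = 0 ∨ a t ω i = 1
  update : ∀ t, 1 ≤ t → ∀ ω i,
    x (t + 1) ω i = (1 - α) * x t ω i + α * ∑ j, W i j * a t ω j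
  bernoulli : ∀ t, 1 ≤ t → ∀ b : Fin N → Bool, ∀ H : Set Ω,
    MeasurableSet[hist x a t] H →
    (μ (H ∩ {ω | ∀ i, a t ω i = if b i then (1 : ℝ) else 0})).toReal
      = ∫ ω in H, ∏ i, (if b i then x t ω i else 1 - x t ω i) ∂μ

/-- `W` is irreducible: the network is strongly connected. -/
def Irreducible {N : ℕ} (W : Matrix (Fin N) (Fin N) ℝ) : Prop :=
  ∀ i j, ∃ n : ℕ, 0 < (W ^ n) i j

/-- The event that `x t i ∈ [0,δ) ∪ (1-δ,1]`. -/
def cti {N : ℕ} (x : ℕ → Ω → Fin N → ℝ) (δ : ℝ) (t : ℕ) (i : Fin N) : Set Ω :=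
  {ω | x t ω i < δ ∨ 1 - δ < x t ω i}

def ct {N : ℕ} (x : ℕ → Ω → Fin N → ℝ) (δ : ℝ) (t : ℕ) : Set Ω :=
  ⋂ i, cti x δ t i

def c0 {N : ℕ} (x : ℕ → Ω → Fin N → ℝ) (δ : ℝ) (t : ℕ) (i : Fin N) : Set Ω :=
  {ω | x t ω i < δ}

def c1 {N : ℕ} (x : ℕ → Ω → Fin N → ℝ) (δ : ℝ) (t : ℕ) (i : Fin N) : Set Ω :=
  {ω | 1 - δ < x t ω i}

/-- The event that every coordinate of `x t` is within `δ` of `0`. -/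
def corner0 {N : ℕ} (x : ℕ → Ω → Fin N → ℝ) (δ : ℝ) (t : ℕ) : Set Ω :=
  {ω | ∀ i, x t ω i < δ}

/-- The event that every coordinate of `x t` is within `δ` of `1`. -/
def corner1 {N : ℕ} (x : ℕ → Ω → Fin N → ℝ) (δ : ℝ) (t : ℕ) : Set Ω :=
  {ω | ∀ i, 1 - δ < x t ω i}

/-- Agents `i` and `j` communicate. -/
def Communicates {N : ℕ} (W : Matrix (Fin N) (Fin N) ℝ) (i j : Fin N) : Prop :=
  (∃ n : ℕ, 0 < (W ^ n) j i) ∧ (∃ n : ℕ, 0 < (W ^ n) i j)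

/-- `C` is a communication class (strongly connected component). -/
def CommClass {N : ℕ} (W : Matrix (Fin N) (Fin N) ℝ) (C : Set (Fin N)) : Prop :=
  ∃ i, C = {j | Communicates W i j}

/-- `C` is a maximal communication class: no agent outside `C` has a directed
path into `C`. -/
def IsMaximalClass {N : ℕ} (W : Matrix (Fin N) (Fin N) ℝ) (C : Set (Fin N)) : Prop :=
  CommClass W C ∧ ∀ i ∈ C, ∀ j, (∃ n : ℕ, 0 < (W ^ n) i j) → j ∈ C

/-- The `0`/`1` vector of a Boolean vector. -/
def actionVec {N : ℕ} (b : Fin N → Bool) : Fin N → ℝ :=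
  fun i => if b i then 1 else 0

/-- The probability that independent Bernoulli variables with parameters `y` take the values `b`. -/
noncomputable def actionProb {N : ℕ} (y : Fin N → ℝ) (b : Fin N → Bool) : ℝ :=
  ∏ i, if b i then y i else 1 - y i

section Combinatorics

variable {N : ℕ} (y : Fin N → ℝ)

theorem sum_prod_mul_actionProb (f : Fin N → Bool → ℝ) :
    ∑ b, (∏ i, f i (b i)) * actionProb y b
      = ∏ i, (f i true * y i + f i false * (1 - y i)) := by
  have h := Fintype.prod_sum
    (fun (i : Fin N) (c : Bool) => f i c * (if c then y i else 1 - y i))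
  simp only [Fintype.sum_bool, if_true, Bool.false_eq_true, if_false] at h
  rw [h]
  refine Finset.sum_congr rfl fun b _ => ?_
  rw [actionProb, ← Finset.prod_mul_distrib]

theorem sum_actionProb : ∑ b, actionProb y b = 1 := by
  have h := sum_prod_mul_actionProb y (fun _ _ => 1)
  simpa using h

theorem sum_sub_mul_actionProb (i : Fin N) :
    ∑ b, (actionVec b i - y i) * actionProb y b = 0 := by
  have h := sum_prod_mul_actionProb y
    (fun m c => if m = i then (if c then 1 else 0) - y m else 1)
  rw [Finset.prod_eq_zero (Finset.mem_univ i) (by simp; ring)] at h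
  simpa [actionVec, Finset.prod_ite_eq'] using h

theorem sum_sub_mul_sub_mul_actionProb (i j : Fin N) :
    ∑ b, (actionVec b i - y i) * (actionVec b j - y j) * actionProb y b
      = if i = j then y i * (1 - y i) else 0 := by
  have h := sum_prod_mul_actionProb y
    (fun m c => (if m = i then (if c then 1 else 0) - y m else 1)
      * (if m = j then (if c then 1 else 0) - y m else 1))
  simp only [Finset.prod_mul_distrib, Finset.prod_ite_eq', Finset.mem_univ, if_true] at h
  simp only [actionVec]
  rw [h]
  by_cases hij : i = j
  · subst hij
    rw [if_pos rfl, Finset.prod_eq_single i]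
    · simp; ring
    · intro m _ hm; simp [hm]
    · simp
  · rw [if_neg hij]
    exact Finset.prod_eq_zero (Finset.mem_univ i) (by simp [hij]; ring)

theorem sum_actionVec_mul_actionProb (i : Fin N) :
    ∑ b, actionVec b i * actionProb y b = y i := by
  have h := sum_sub_mul_actionProb y i
  simp only [sub_mul, Finset.sum_sub_distrib, ← Finset.mul_sum, sum_actionProb] at h
  linarith

theorem sum_sq_mul_actionProb (c : ℝ) (w : Fin N → ℝ) :
    ∑ b, (c + ∑ i, w i * (actionVec b i - y i)) ^ 2 * actionProb y b
      = c ^ 2 + ∑ i, w i ^ 2 * (y i * (1 - y i)) := by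
  have expand : ∀ b, (c + ∑ i, w i * (actionVec b i - y i)) ^ 2 * actionProb y b
      = c ^ 2 * actionProb y b
        + ∑ i, 2 * c * w i * ((actionVec b i - y i) * actionProb y b)
        + ∑ i, ∑ j, w i * w j
          * ((actionVec b i - y i) * (actionVec b j - y j) * actionProb y b) := by
    intro b
    have h1 : ∑ i, 2 * c * w i * ((actionVec b i - y i) * actionProb y b)
        = 2 * c * (∑ i, w i * (actionVec b i - y i)) * actionProb y b := by
      rw [Finset.mul_sum, Finset.sum_mul]
      exact Finset.sum_congr rfl fun i _ => by ring
    have h2 : ∑ i, ∑ j, w i * w j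
          * ((actionVec b i - y i) * (actionVec b j - y j) * actionProb y b)
        = (∑ i, w i * (actionVec b i - y i)) * (∑ i, w i * (actionVec b i - y i))
          * actionProb y b := by
      rw [Finset.sum_mul_sum, Finset.sum_mul]
      refine Finset.sum_congr rfl fun i _ => ?_
      rw [Finset.sum_mul]
      exact Finset.sum_congr rfl fun j _ => by ring
    rw [h1, h2]
    ring
  simp only [expand, Finset.sum_add_distrib]
  rw [← Finset.mul_sum, sum_actionProb, Finset.sum_comm (s := Finset.univ (α := Fin N → Bool))]
  simp only [← Finset.mul_sum, sum_sub_mul_actionProb]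
  rw [Finset.sum_comm (s := Finset.univ (α := Fin N → Bool))]
  have h3 : ∀ i, ∑ b : Fin N → Bool, ∑ j, w i * w j
      * ((actionVec b i - y i) * (actionVec b j - y j) * actionProb y b)
      = w i ^ 2 * (y i * (1 - y i)) := by
    intro i
    rw [Finset.sum_comm]
    simp only [← Finset.mul_sum, sum_sub_mul_sub_mul_actionProb]
    simp [pow_two]
  simp only [h3]
  simp

theorem actionProb_nonneg (hy : ∀ i, y i ∈ Set.Icc (0 : ℝ) 1) (b : Fin N → Bool) :
    0 ≤ actionProb y b := by
  refine Finset.prod_nonneg fun i _ => ?_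
  have := hy i
  split_ifs
  · exact this.1
  · linarith [this.2]

theorem actionProb_le_one (hy : ∀ i, y i ∈ Set.Icc (0 : ℝ) 1) (b : Fin N → Bool) :
    actionProb y b ≤ 1 := by
  rw [← sum_actionProb y]
  exact Finset.single_le_sum (fun c _ => actionProb_nonneg y hy c) (Finset.mem_univ b)

theorem measurable_actionProb (b : Fin N → Bool) :
    Measurable fun y : Fin N → ℝ => actionProb y b := by
  unfold actionProb
  refine Finset.measurable_prod _ fun i _ => ?_
  split_ifs <;> fun_prop

end Combinatorics

/-- An irreducible stochastic matrix has a strictly positive stationary vector. -/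
theorem exists_pos_stationary {N : ℕ} (hN : 1 ≤ N) {W : Matrix (Fin N) (Fin N) ℝ}
    (hW : ∀ i j, 0 ≤ W i j) (hrow : ∀ i, ∑ j, W i j = 1) (hirr : Irreducible W) :
    ∃ w : Fin N → ℝ, (∀ i, 0 < w i) ∧ ∀ j, ∑ i, w i * W i j = w j := by
  have hne : Nonempty (Fin N) := ⟨⟨0, hN⟩⟩
  have hdet : (W - 1).det = 0 := by
    refine Matrix.exists_mulVec_eq_zero_iff.mp ⟨fun _ => 1, ?_, ?_⟩
    · intro h
      exact one_ne_zero (congrFun h hne.some)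
    · ext i
      simp [Matrix.mulVec, dotProduct, hrow, Matrix.one_apply]
  obtain ⟨v, hv0, hv⟩ := Matrix.exists_vecMul_eq_zero_iff.mpr hdet
  have hvW : ∀ j, ∑ i, v i * W i j = v j := by
    intro j
    have := congrFun hv j
    simp only [Matrix.vecMul_sub, Matrix.vecMul_one, Pi.sub_apply, Pi.zero_apply] at this
    simpa [Matrix.vecMul, dotProduct] using sub_eq_zero.mp this
  have hle : ∀ j, |v j| ≤ ∑ i, |v i| * W i j := by
    intro j
    calc |v j| = |∑ i, v i * W i j| := by rw [hvW]
      _ ≤ ∑ i, |v i * W i j| := Finset.abs_sum_le_sum_abs _ _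
      _ = _ := Finset.sum_congr rfl fun i _ => by rw [abs_mul, abs_of_nonneg (hW i j)]
  have hsum : ∑ j, |v j| = ∑ j, ∑ i, |v i| * W i j := by
    rw [Finset.sum_comm]
    simp [← Finset.mul_sum, hrow]
  have hstat : ∀ j, ∑ i, |v i| * W i j = |v j| := fun j =>
    (((Finset.sum_eq_sum_iff_of_le fun j _ => hle j).mp hsum) j (Finset.mem_univ j)).symm
  refine ⟨fun i => |v i|, fun j => ?_, hstat⟩
  have hpow : ∀ n : ℕ, Matrix.vecMul (fun i => |v i|) (W ^ n) = fun i => |v i| := by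
    intro n
    induction n with
    | zero => simp
    | succ n ih =>
      rw [pow_succ, ← Matrix.vecMul_vecMul, ih]
      ext j
      simpa [Matrix.vecMul, dotProduct] using hstat j
  have hpow_nonneg : ∀ n : ℕ, ∀ i j, 0 ≤ (W ^ n) i j := by
    intro n
    induction n with
    | zero => intro i j; simp only [pow_zero, Matrix.one_apply]; split_ifs <;> norm_num
    | succ n ih =>
      intro i j
      rw [pow_succ, Matrix.mul_apply]
      exact Finset.sum_nonneg fun m _ => mul_nonneg (ih i m) (hW m j)
  obtain ⟨i, hi⟩ := Function.ne_iff.mp hv0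
  obtain ⟨n, hn⟩ := hirr i j
  have h := congrFun (hpow n) j
  simp only [Matrix.vecMul, dotProduct] at h
  change 0 < |v j|
  rw [← h]
  exact (mul_pos (abs_pos.mpr hi) hn).trans_le (Finset.single_le_sum
    (f := fun i => |v i| * (W ^ n) i j)
    (fun m _ => mul_nonneg (abs_nonneg _) (hpow_nonneg n m j)) (Finset.mem_univ i))

section Model

variable [MeasurableSpace Ω] {N : ℕ} {μ : Measure Ω} {α : ℝ} {W : Matrix (Fin N) (Fin N) ℝ}
  {x a : ℕ → Ω → Fin N → ℝ}

theorem comap_le_hist {t : ℕ} (ht : 1 ≤ t) :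
    MeasurableSpace.comap (x t) inferInstance ≤ hist x a t :=
  le_sup_of_le_left (le_iSup₂_of_le t (Finset.mem_Icc.mpr ⟨ht, le_rfl⟩) le_rfl)

theorem measurableSet_action (hRA : IsRAModel μ α W x a) (t : ℕ) (b : Fin N → Bool) :
    MeasurableSet {ω | a t ω = actionVec b} :=
  hRA.a_meas t (measurableSet_singleton _)

theorem map_restrict_action (hRA : IsRAModel μ α W x a) {t : ℕ} (ht : 1 ≤ t)
    (b : Fin N → Bool) :
    (μ.restrict {ω | a t ω = actionVec b}).map (x t)
      = (μ.withDensity fun ω => ENNReal.ofReal (actionProb (x t ω) b)).map (x t) := by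
  have := hRA.isProb
  have hx := hRA.x_meas t
  ext S hS
  have hxS : MeasurableSet (x t ⁻¹' S) := hx hS
  rw [Measure.map_apply hx hS, Measure.map_apply hx hS, Measure.restrict_apply hxS,
    withDensity_apply _ hxS]
  have h := hRA.bernoulli t ht b (x t ⁻¹' S) (comap_le_hist ht _ ⟨S, hS, rfl⟩)
  have hset : {ω | ∀ i, a t ω i = if b i then (1 : ℝ) else 0} = {ω | a t ω = actionVec b} := by
    ext ω
    simp [funext_iff, actionVec]
  rw [hset] at h
  rw [← ENNReal.ofReal_toReal (measure_ne_top μ _), h, ofReal_integral_eq_lintegral_ofReal]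
  · rfl
  · refine Integrable.of_bound (C := 1)
      ((measurable_actionProb b).comp hx).aestronglyMeasurable ?_
    refine Eventually.of_forall fun ω => ?_
    change ‖actionProb (x t ω) b‖ ≤ 1
    rw [Real.norm_of_nonneg (actionProb_nonneg _ (hRA.x_mem t ht ω) b)]
    exact actionProb_le_one _ (hRA.x_mem t ht ω) b
  · exact Eventually.of_forall fun ω => actionProb_nonneg _ (hRA.x_mem t ht ω) b

theorem setIntegral_action (hRA : IsRAModel μ α W x a) {t : ℕ} (ht : 1 ≤ t)
    (b : Fin N → Bool) {g : (Fin N → ℝ) → ℝ} (hg : Measurable g) :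
    ∫ ω in {ω | a t ω = actionVec b}, g (x t ω) ∂μ
      = ∫ ω, g (x t ω) * actionProb (x t ω) b ∂μ := by
  have hx := hRA.x_meas t
  have hp : Measurable fun ω => actionProb (x t ω) b := (measurable_actionProb b).comp hx
  rw [← integral_map hx.aemeasurable hg.aestronglyMeasurable, map_restrict_action hRA ht b,
    integral_map hx.aemeasurable hg.aestronglyMeasurable,
    integral_withDensity_eq_integral_toReal_smul
      hp.ennreal_ofReal
      (Eventually.of_forall fun _ => ENNReal.ofReal_lt_top)]
  refine integral_congr_ae (Eventually.of_forall fun ω => ?_)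
  simp only [smul_eq_mul]
  rw [ENNReal.toReal_ofReal (actionProb_nonneg _ (hRA.x_mem t ht ω) b), mul_comm]

/-- The expectation of a function of the current opinions and actions is obtained by first
averaging over the actions. -/
theorem integral_action (hRA : IsRAModel μ α W x a) {t : ℕ} (ht : 1 ≤ t)
    {G : (Fin N → ℝ) → (Fin N → ℝ) → ℝ} (hG : ∀ b, Measurable fun y => G y (actionVec b))
    {C : ℝ} (hC : ∀ y : Fin N → ℝ, (∀ i, y i ∈ Set.Icc (0 : ℝ) 1) →
      ∀ b, |G y (actionVec b)| ≤ C) :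
    ∫ ω, G (x t ω) (a t ω) ∂μ
      = ∫ ω, ∑ b, G (x t ω) (actionVec b) * actionProb (x t ω) b ∂μ := by
  have := hRA.isProb
  have hx := hRA.x_meas t
  have hinj : ∀ b c : Fin N → Bool, actionVec b = actionVec c → b = c := by
    intro b c h
    ext i
    have := congrFun h i
    simp only [actionVec] at this
    cases hb : b i <;> cases hc : c i <;> simp_all
  have hint : ∀ b, Integrable (fun ω => G (x t ω) (actionVec b)) μ := fun b =>
    Integrable.of_bound (C := C) ((hG b).comp hx).aestronglyMeasurable
      (Eventually.of_forall fun ω => hC _ (hRA.x_mem t ht ω) b)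
  have hsplit : ∀ ω, G (x t ω) (a t ω)
      = ∑ b, {ω | a t ω = actionVec b}.indicator (fun ω => G (x t ω) (actionVec b)) ω := by
    intro ω
    obtain ⟨c, hc⟩ : ∃ c, a t ω = actionVec c := by
      refine ⟨fun i => decide (a t ω i = 1), ?_⟩
      ext i
      rcases hRA.a_mem t ht ω i with h | h <;> simp [actionVec, h]
    rw [Finset.sum_eq_single c]
    · simp [Set.indicator, hc]
    · intro b _ hb
      refine Set.indicator_of_notMem (fun h => hb ?_) _
      exact hinj _ _ (h.symm.trans hc)
    · simp
  simp only [hsplit]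
  rw [integral_finsetSum _ fun b _ => (hint b).indicator (measurableSet_action hRA t b),
    integral_finsetSum]
  · refine Finset.sum_congr rfl fun b _ => ?_
    rw [integral_indicator (measurableSet_action hRA t b)]
    exact setIntegral_action hRA ht b (hG b)
  · intro b _
    refine (hint b).mul_bdd (c := 1) ((measurable_actionProb b).comp hx).aestronglyMeasurable ?_
    refine Eventually.of_forall fun ω => ?_
    rw [Real.norm_of_nonneg (actionProb_nonneg _ (hRA.x_mem t ht ω) b)]
    exact actionProb_le_one _ (hRA.x_mem t ht ω) b

theorem integrable_comp (hRA : IsRAModel μ α W x a) {t : ℕ} (ht : 1 ≤ t)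
    {g : (Fin N → ℝ) → ℝ} (hg : Measurable g) {C : ℝ}
    (hC : ∀ y : Fin N → ℝ, (∀ i, y i ∈ Set.Icc (0 : ℝ) 1) → |g y| ≤ C) :
    Integrable (fun ω => g (x t ω)) μ := by
  have := hRA.isProb
  exact Integrable.of_bound (C := C) (hg.comp (hRA.x_meas t)).aestronglyMeasurable
    (Eventually.of_forall fun ω => hC _ (hRA.x_mem t ht ω))

theorem abs_mul_one_sub_le {r : ℝ} (hr : r ∈ Set.Icc (0 : ℝ) 1) :
    |r * (1 - r)| ≤ 1 := by
  obtain ⟨h0, h1⟩ := hr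
  rw [abs_le]
  constructor <;> nlinarith

theorem integrable_mul_one_sub (hRA : IsRAModel μ α W x a) {t : ℕ} (ht : 1 ≤ t)
    (k : Fin N) : Integrable (fun ω => x t ω k * (1 - x t ω k)) μ :=
  integrable_comp hRA ht (g := fun y => y k * (1 - y k)) (by fun_prop)
    (fun _ hy => abs_mul_one_sub_le (hy k))

theorem abs_weighted_sum_le (w y : Fin N → ℝ) (hy : ∀ i, y i ∈ Set.Icc (0 : ℝ) 1) :
    |∑ i, w i * y i| ≤ ∑ i, |w i| := by
  refine (Finset.abs_sum_le_sum_abs _ _).trans (Finset.sum_le_sum fun i _ => ?_)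
  rw [abs_mul, abs_of_nonneg (hy i).1]
  exact mul_le_of_le_one_right (abs_nonneg _) (hy i).2

theorem abs_sq_weighted_sum_le (w y : Fin N → ℝ) (hy : ∀ i, y i ∈ Set.Icc (0 : ℝ) 1) :
    |(∑ i, w i * y i) ^ 2| ≤ (∑ i, |w i|) ^ 2 := by
  rw [abs_pow]
  exact pow_le_pow_left₀ (abs_nonneg _) (abs_weighted_sum_le w y hy) 2

theorem actionVec_mem (b : Fin N → Bool) (i : Fin N) :
    actionVec b i ∈ Set.Icc (0 : ℝ) 1 := by
  simp only [actionVec]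
  split_ifs <;> simp

/-- The second moment of the stationary average grows by the averaged Bernoulli variances. -/
theorem integral_sq_weighted_succ (hRA : IsRAModel μ α W x a) {w : Fin N → ℝ}
    (hw : ∀ j, ∑ i, w i * W i j = w j) {t : ℕ} (ht : 1 ≤ t) :
    ∫ ω, (∑ i, w i * x (t + 1) ω i) ^ 2 ∂μ
      = ∫ ω, ((∑ i, w i * x t ω i) ^ 2
          + ∑ i, (α * w i) ^ 2 * (x t ω i * (1 - x t ω i))) ∂μ := by
  obtain ⟨hα0, hα1⟩ := hRA.alpha_mem
  have hupd : ∀ ω, ∑ i, w i * x (t + 1) ω i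
      = ∑ i, w i * x t ω i + ∑ i, α * w i * (a t ω i - x t ω i) := by
    intro ω
    have h1 : ∑ i, w i * ∑ j, W i j * a t ω j = ∑ j, w j * a t ω j := by
      simp only [Finset.mul_sum]
      rw [Finset.sum_comm]
      refine Finset.sum_congr rfl fun j _ => ?_
      rw [← hw j, Finset.sum_mul]
      exact Finset.sum_congr rfl fun i _ => by ring
    have h2 : ∑ i, w i * x (t + 1) ω i
        = ∑ i, (1 - α) * (w i * x t ω i) + α * ∑ i, w i * ∑ j, W i j * a t ω j := by
      rw [Finset.mul_sum, ← Finset.sum_add_distrib]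
      refine Finset.sum_congr rfl fun i _ => ?_
      rw [hRA.update t ht]
      ring
    rw [h2, h1, Finset.mul_sum, ← Finset.sum_add_distrib, ← Finset.sum_add_distrib]
    exact Finset.sum_congr rfl fun i _ => by ring
  simp only [hupd]
  rw [integral_action hRA ht (C := (∑ i, |w i|) ^ 2)
    (G := fun y c => (∑ i, w i * y i + ∑ i, α * w i * (c i - y i)) ^ 2)
    (fun b => by fun_prop)]
  · simp only [sum_sq_mul_actionProb]
  · intro y hy b
    have : ∑ i, w i * y i + ∑ i, α * w i * (actionVec b i - y i)
        = ∑ i, w i * ((1 - α) * y i + α * actionVec b i) := by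
      rw [← Finset.sum_add_distrib]
      exact Finset.sum_congr rfl fun i _ => by ring
    simp only [this]
    refine abs_sq_weighted_sum_le w _ fun i => ?_
    obtain ⟨hy0, hy1⟩ := hy i
    obtain ⟨hb0, hb1⟩ := actionVec_mem b i
    constructor <;> nlinarith

theorem tendsto_integral_mul_one_sub (hN : 1 ≤ N) (hRA : IsRAModel μ α W x a)
    (hirr : Irreducible W) (k : Fin N) :
    Tendsto (fun t => ∫ ω, x t ω k * (1 - x t ω k) ∂μ) atTop (nhds 0) := by
  have := hRA.isProb
  obtain ⟨w, hwpos, hw⟩ := exists_pos_stationary hN hRA.W_nonneg hRA.W_rowsum hirr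
  set m : ℕ → ℝ := fun t => ∫ ω, (∑ i, w i * x (t + 1) ω i) ^ 2 ∂μ with hm
  set v : ℕ → ℝ := fun t => ∫ ω, x (t + 1) ω k * (1 - x (t + 1) ω k) ∂μ with hv
  have hc : 0 < (α * w k) ^ 2 := pow_pos (mul_pos hRA.alpha_mem.1 (hwpos k)) 2
  have hintsq : ∀ t, Integrable (fun ω => (∑ i, w i * x (t + 1) ω i) ^ 2) μ := fun t =>
    integrable_comp hRA (Nat.le_add_left 1 t) (g := fun y => (∑ i, w i * y i) ^ 2) (by fun_prop)
      (abs_sq_weighted_sum_le w)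
  have hx01 : ∀ t ω i, 0 ≤ x (t + 1) ω i * (1 - x (t + 1) ω i) := fun t ω i =>
    have h := hRA.x_mem (t + 1) (Nat.le_add_left 1 t) ω i
    mul_nonneg h.1 (sub_nonneg.mpr h.2)
  have hv0 : ∀ t, 0 ≤ v t := fun t => integral_nonneg fun ω => hx01 t ω k
  have hstep : ∀ t, (α * w k) ^ 2 * v t ≤ m (t + 1) - m t := by
    intro t
    have ht : 1 ≤ t + 1 := Nat.le_add_left 1 t
    have hints : ∀ i, Integrable
        (fun ω => (α * w i) ^ 2 * (x (t + 1) ω i * (1 - x (t + 1) ω i))) μ :=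
      fun i => (integrable_mul_one_sub hRA ht i).const_mul _
    have h := integral_sq_weighted_succ hRA hw ht
    rw [integral_add (hintsq t) (integrable_finsetSum _ fun i _ => hints i),
      integral_finsetSum _ fun i _ => hints i] at h
    have hk : (α * w k) ^ 2 * v t
        ≤ ∑ i, ∫ ω, (α * w i) ^ 2 * (x (t + 1) ω i * (1 - x (t + 1) ω i)) ∂μ := by
      rw [hv]
      simp only
      rw [← integral_const_mul]
      exact Finset.single_le_sum
        (f := fun i => ∫ ω, (α * w i) ^ 2 * (x (t + 1) ω i * (1 - x (t + 1) ω i)) ∂μ)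
        (fun i _ => integral_nonneg fun ω => mul_nonneg (sq_nonneg _) (hx01 t ω i))
        (Finset.mem_univ k)
    simp only [hm]
    linarith
  have hmono : Monotone m := monotone_nat_of_le_succ fun t => by
    have := mul_nonneg hc.le (hv0 t)
    linarith [hstep t]
  have hbdd : BddAbove (Set.range m) := by
    refine ⟨(∑ i, |w i|) ^ 2, ?_⟩
    rintro _ ⟨t, rfl⟩
    calc m t ≤ ∫ _, (∑ i, |w i|) ^ 2 ∂μ :=
          integral_mono (hintsq t) (integrable_const _) fun ω =>
            (le_abs_self _).trans
              (abs_sq_weighted_sum_le w _ (hRA.x_mem (t + 1) (Nat.le_add_left 1 t) ω))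
      _ = _ := by simp
  have hlim := tendsto_atTop_ciSup hmono hbdd
  have hdiff : Tendsto (fun t => (m (t + 1) - m t) / (α * w k) ^ 2) atTop (nhds 0) := by
    simpa using ((hlim.comp (tendsto_add_atTop_nat 1)).sub hlim).div_const ((α * w k) ^ 2)
  have hvlim : Tendsto v atTop (nhds 0) :=
    squeeze_zero hv0 (fun t => by rw [le_div_iff₀ hc, mul_comm]; exact hstep t) hdiff
  exact (tendsto_add_atTop_iff_nat 1).mp hvlim

/-- If from `S` the action of agent `l`, recorded by `r 0` or `r 1`, forces the next opinion of
agent `k` into `[δ, 1 - δ]`, then `S` has small probability. -/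
theorem measure_preimage_le (hRA : IsRAModel μ α W x a) {t : ℕ} (ht : 1 ≤ t)
    {k l : Fin N} {δ p q : ℝ} (hδ0 : 0 < δ) (hδ1 : δ < 1) {S : Set (Fin N → ℝ)}
    (hS : MeasurableSet S) (hpq : ∀ r ∈ Set.Icc (0 : ℝ) 1, |p * r + q| ≤ 1)
    (hprob : ∀ y ∈ S, 1 - δ ≤ p * y l + q)
    (hnext : ∀ ω, x t ω ∈ S → p * a t ω l + q ≤ 0 ∨
      x (t + 1) ω k ∈ Set.Icc δ (1 - δ)) :
    (μ (x t ⁻¹' S)).toReal * (δ * (1 - δ) ^ 2)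
      ≤ ∫ ω, x (t + 1) ω k * (1 - x (t + 1) ω k) ∂μ := by
  have := hRA.isProb
  have hx := hRA.x_meas t
  have hind : Measurable (S.indicator fun _ : Fin N → ℝ => (1 : ℝ)) :=
    measurable_const.indicator hS
  have hindle : ∀ y, |S.indicator (fun _ : Fin N → ℝ => (1 : ℝ)) y| ≤ 1 := by
    intro y
    by_cases h : y ∈ S <;> simp [h]
  have habs : ∀ y (r : ℝ), r ∈ Set.Icc (0 : ℝ) 1 →
      |S.indicator (fun _ : Fin N → ℝ => (1 : ℝ)) y * (p * r + q)| ≤ 1 := by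
    intro y r hr
    rw [abs_mul]
    exact mul_le_one₀ (hindle y) (abs_nonneg _) (hpq r hr)
  have hmean := integral_action hRA ht (C := 1)
    (G := fun y c => S.indicator (fun _ => (1 : ℝ)) y * (p * c l + q))
    (fun b => hind.mul_const _) (fun y _ b => habs y _ (actionVec_mem b l))
  have havg : ∀ y : Fin N → ℝ, ∑ b, S.indicator (fun _ => (1 : ℝ)) y * (p * actionVec b l + q)
      * actionProb y b = S.indicator (fun _ => (1 : ℝ)) y * (p * y l + q) := by
    intro y
    have : ∀ b, S.indicator (fun _ => (1 : ℝ)) y * (p * actionVec b l + q) * actionProb y b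
        = S.indicator (fun _ => (1 : ℝ)) y * p * (actionVec b l * actionProb y b)
          + S.indicator (fun _ => (1 : ℝ)) y * q * actionProb y b := fun b => by ring
    simp only [this]
    rw [Finset.sum_add_distrib, ← Finset.mul_sum, ← Finset.mul_sum, sum_actionProb,
      sum_actionVec_mul_actionProb]
    ring
  simp only [havg] at hmean
  have hlower : (μ (x t ⁻¹' S)).toReal * (1 - δ)
      ≤ ∫ ω, S.indicator (fun _ => (1 : ℝ)) (x t ω) * (p * x t ω l + q) ∂μ := by
    have h1 : (μ (x t ⁻¹' S)).toReal * (1 - δ)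
        = ∫ ω, S.indicator (fun _ => (1 : ℝ)) (x t ω) * (1 - δ) ∂μ := by
      rw [integral_mul_const]
      congr 1
      exact (integral_indicator_one (hx hS)).symm
    rw [h1]
    refine integral_mono
      (integrable_comp hRA ht (g := fun y => S.indicator (fun _ => (1 : ℝ)) y * (1 - δ))
        (hind.mul_const _) (C := 1) fun y _ => ?_)
      (integrable_comp hRA ht
        (g := fun y => S.indicator (fun _ => (1 : ℝ)) y * (p * y l + q))
        (hind.mul (by fun_prop)) fun y hy => habs y _ (hy l)) fun ω => ?_
    · rw [abs_mul]
      exact mul_le_one₀ (hindle y) (abs_nonneg _) (by rw [abs_le]; constructor <;> linarith)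
    · by_cases h : x t ω ∈ S
      · simpa [h] using hprob _ h
      · simp [h]
  have hupper : (∫ ω, S.indicator (fun _ => (1 : ℝ)) (x t ω) * (p * a t ω l + q) ∂μ)
      * (δ * (1 - δ)) ≤ ∫ ω, x (t + 1) ω k * (1 - x (t + 1) ω k) ∂μ := by
    have ha : ∀ ω, a t ω l ∈ Set.Icc (0 : ℝ) 1 := by
      intro ω
      rcases hRA.a_mem t ht ω l with h | h <;> simp [h]
    have hal : Measurable fun ω => a t ω l := (measurable_pi_apply l).comp (hRA.a_meas t)
    rw [← integral_mul_const]
    refine integral_mono (Integrable.mul_const (Integrable.of_bound (C := 1) ?_ ?_) _)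
      (integrable_mul_one_sub hRA (Nat.le_add_left 1 t) k) fun ω => ?_
    · exact ((hind.comp hx).mul ((hal.const_mul p).add_const q)).aestronglyMeasurable
    · exact Eventually.of_forall fun ω => habs _ _ (ha ω)
    · have hnn : 0 ≤ x (t + 1) ω k * (1 - x (t + 1) ω k) :=
        have h := hRA.x_mem (t + 1) (Nat.le_add_left 1 t) ω k
        mul_nonneg h.1 (sub_nonneg.mpr h.2)
      have hδδ : 0 < δ * (1 - δ) := mul_pos hδ0 (by linarith)
      by_cases h : x t ω ∈ S
      · simp only [h, Set.indicator_of_mem, one_mul]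
        rcases hnext ω h with h' | ⟨h1, h2⟩
        · nlinarith
        · have := (abs_le.mp (hpq _ (ha ω))).2
          nlinarith
      · simpa [h] using hnn
  rw [hmean] at hupper
  have : 0 < δ * (1 - δ) := mul_pos hδ0 (by linarith)
  nlinarith

end Model

theorem prob_opposite_corners_small {Ω : Type*} [MeasurableSpace Ω] {N : ℕ} (hN : 1 ≤ N)
    (μ : Measure Ω) (α : ℝ) (W : Matrix (Fin N) (Fin N) ℝ)
    (x a : ℕ → Ω → Fin N → ℝ) (hRA : IsRAModel μ α W x a)
    (hirr : Irreducible W) (k l : Fin N) (hkl : 0 < W k l) :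
    ∀ δ > (0 : ℝ), δ ≤ min (α * W k l) ((1 - α) / (2 - α)) →
      ∀ ε > (0 : ℝ), ∃ tε : ℕ, ∀ t ≥ tε,
        (μ (c0 x δ t k ∩ c1 x δ t l)).toReal ≤ δ + ε
        ∧ (μ (c1 x δ t k ∩ c0 x δ t l)).toReal ≤ δ + ε := by
  intro δ hδ hδmin ε hε
  obtain ⟨hα0, hα1⟩ := hRA.alpha_mem
  have hδW : δ ≤ α * W k l := hδmin.trans (min_le_left _ _)
  have hδα : δ * (2 - α) ≤ 1 - α :=
    (le_div_iff₀ (by linarith)).mp (hδmin.trans (min_le_right _ _))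
  have hδ1 : δ < 1 := by nlinarith
  have hc : 0 < δ * (1 - δ) ^ 2 := mul_pos hδ (pow_pos (by linarith) 2)
  have hlim := (tendsto_add_atTop_iff_nat 1).mpr (tendsto_integral_mul_one_sub hN hRA hirr k)
  obtain ⟨T, hT⟩ := eventually_atTop.mp (hlim.eventually_lt_const (mul_pos hε hc))
  refine ⟨max T 1, fun t ht => ?_⟩
  have ht1 : 1 ≤ t := (le_max_right _ _).trans ht
  have hsmall := hT t ((le_max_left _ _).trans ht)
  have ha : ∀ ω j, 0 ≤ a t ω j ∧ a t ω j ≤ 1 := by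
    intro ω j
    rcases hRA.a_mem t ht1 ω j with h | h <;> simp [h]
  have hnn : ∀ ω, W k l * a t ω l ≤ ∑ j, W k j * a t ω j := fun ω =>
    Finset.single_le_sum (f := fun j => W k j * a t ω j)
      (fun j _ => mul_nonneg (hRA.W_nonneg k j) (ha ω j).1) (Finset.mem_univ l)
  have hle : ∀ ω, W k l * (1 - a t ω l) ≤ 1 - ∑ j, W k j * a t ω j := by
    intro ω
    have h := Finset.single_le_sum (f := fun j => W k j * (1 - a t ω j))
      (fun j _ => mul_nonneg (hRA.W_nonneg k j) (sub_nonneg.mpr (ha ω j).2)) (Finset.mem_univ l)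
    simp only [mul_sub, mul_one, Finset.sum_sub_distrib, hRA.W_rowsum k] at h ⊢
    exact h
  constructor
  · have h := measure_preimage_le hRA ht1 (k := k) (l := l) (p := 1) (q := 0) hδ hδ1
      (S := {y | y k < δ ∧ 1 - δ < y l})
      ((measurableSet_lt (measurable_pi_apply k) measurable_const).inter
        (measurableSet_lt measurable_const (measurable_pi_apply l)))
      (fun r hr => by rw [one_mul, add_zero, abs_of_nonneg hr.1]; exact hr.2)
      (fun y hy => by linarith [hy.2])
      (fun ω hω => by
        rcases hRA.a_mem t ht1 ω l with h | h
        · left; simp [h]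
        · right
          have h1 := hnn ω
          have h2 := hle ω
          have h3 := (hRA.x_mem t ht1 ω k).1
          have h4 : x t ω k < δ := hω.1
          rw [h] at h1 h2
          rw [hRA.update t ht1 ω k]
          constructor <;> nlinarith)
    have h' := lt_of_mul_lt_mul_right (h.trans_lt hsmall) hc.le
    change (μ (x t ⁻¹' {y | y k < δ ∧ 1 - δ < y l})).toReal ≤ δ + ε
    linarith
  · have h := measure_preimage_le hRA ht1 (k := k) (l := l) (p := -1) (q := 1) hδ hδ1
      (S := {y | 1 - δ < y k ∧ y l < δ})
      ((measurableSet_lt measurable_const (measurable_pi_apply k)).inter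
        (measurableSet_lt (measurable_pi_apply l) measurable_const))
      (fun r hr => by rw [abs_le]; constructor <;> linarith [hr.1, hr.2])
      (fun y hy => by linarith [hy.2])
      (fun ω hω => by
        rcases hRA.a_mem t ht1 ω l with h | h
        · right
          have h1 := hnn ω
          have h2 := hle ω
          have h3 := (hRA.x_mem t ht1 ω k).2
          have h4 : 1 - δ < x t ω k := hω.1
          rw [h] at h1 h2
          rw [hRA.update t ht1 ω k]
          constructor <;> nlinarith
        · left; simp [h])
    have h' := lt_of_mul_lt_mul_right (h.trans_lt hsmall) hc.le
    change (μ (x t ⁻¹' {y | 1 - δ < y k ∧ y l < δ})).toReal ≤ δ + ε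
    linarith

end RA
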